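/- The function $w(x)=|x|^{1/2}$ is an $A_2(\mathbb{R})$ weight; nevertheless, there is no constant $N$ such that $\int_{\mathbb{R}}|g(\xi)|^2|\xi|^{-1/2}d\xi\le N\int_{\mathbb{R}}|g(\xi)|^2|\xi|^{1/2}d\xi$ holds for every Schwartz function $g$ on $\mathbb{R}$. (Consequently, Parseval's identity, in the form of a two-sided norm equivalence between $\|h\|_{L_2(w)}$ and $\|\mathcal{F}h\|_{L_2(w)}$ for all Schwartz $h$, fails in the weighted space $L_2(\mathbb{R},w\,dx)$.) -/

import Mathlib

open MeasureTheory Metric Filter Set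
open scoped ENNReal NNReal FourierTransform Topology Classical BigOperators

noncomputable section

/-- `d`-dimensional Euclidean space. -/
abbrev Rd (d : ℕ) := EuclideanSpace ℝ (Fin d)

/-- The Muckenhoupt `A_p` ratio of a weight `w` over the ball `B(c,r)`. -/
def apRatio {E : Type*} [NormedAddCommGroup E] [MeasureSpace E] (p : ℝ) (w : E → ℝ)
    (c : E) (r : ℝ) : ℝ :=
  (⨍ x in ball c r, w x) * (⨍ x in ball c r, (w x) ^ (-(1 : ℝ) / (p - 1))) ^ (p - 1)

/-- `w` is a Muckenhoupt `A_p` weight: nonnegative, locally integrable, with the `A_p`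
ratios uniformly bounded over all balls. -/
structure IsAp {E : Type*} [NormedAddCommGroup E] [MeasureSpace E] (p : ℝ) (w : E → ℝ) : Prop where
  nonneg : ∀ x, 0 ≤ w x
  locInt : LocallyIntegrable w volume
  bdd : BddAbove (Set.range fun cr : E × {r : ℝ // 0 < r} => apRatio p w cr.1 cr.2.1)

/-- The Muckenhoupt characteristic `[w]_p`. -/
def apConst {E : Type*} [NormedAddCommGroup E] [MeasureSpace E] (p : ℝ) (w : E → ℝ) : ℝ :=
  ⨆ cr : E × {r : ℝ // 0 < r}, apRatio p w cr.1 cr.2.1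

/-- The weighted `L_p` (quasi-)norm `‖u‖_{L_p(w)}`, valued in `ℝ≥0∞`. -/
def wLp {E : Type*} [NormedAddCommGroup E] [MeasureSpace E] (p : ℝ) (w : E → ℝ)
    (u : E → ℂ) : ℝ≥0∞ :=
  (∫⁻ x, (‖u x‖₊ : ℝ≥0∞) ^ p * ENNReal.ofReal (w x)) ^ (1 / p)

/-- The Bessel potential operator `(1-Δ)^{γ/2}`, as a Fourier multiplier. -/
def bessel {d : ℕ} (γ : ℝ) (u : Rd d → ℂ) : Rd d → ℂ :=
  𝓕⁻ fun ξ : Rd d => (((1 : ℝ) + ‖ξ‖ ^ 2) ^ (γ / 2) : ℝ) • 𝓕 u ξ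

/-- The Fourier multiplier `(λ - Δ)^{s}` with symbol `(λ + |ξ|²)^s`. -/
def besselL {d : ℕ} (lam s : ℝ) (u : Rd d → ℂ) : Rd d → ℂ :=
  𝓕⁻ fun ξ : Rd d => ((lam + ‖ξ‖ ^ 2) ^ s : ℝ) • 𝓕 u ξ

/-- The norm of the weighted Bessel-potential space `H^γ_p(w)`. -/
def hNorm {d : ℕ} (γ p : ℝ) (w : Rd d → ℝ) (u : Rd d → ℂ) : ℝ≥0∞ :=
  wLp p w (bessel γ u)

/-- The norm of `𝔹H^γ_{q,p}(w₂,w₁,T) = L_q((0,T),w₂dt;H^γ_p(w₁))`. -/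
def mixNorm {d : ℕ} (γ q p : ℝ) (w2 : ℝ → ℝ) (w1 : Rd d → ℝ) (T : ℝ)
    (u : ℝ → Rd d → ℂ) : ℝ≥0∞ :=
  (∫⁻ t in Set.Ioo (0 : ℝ) T, hNorm γ p w1 (u t) ^ q * ENNReal.ofReal (w2 t)) ^ (1 / q)

/-- Riemann-Liouville fractional integral `I^β_t`. -/
def RL (β : ℝ) (φ : ℝ → ℂ) (t : ℝ) : ℂ :=
  (Real.Gamma β)⁻¹ • ∫ s in Set.Ioc (0 : ℝ) t, ((t - s) ^ (β - 1) : ℝ) • φ s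

/-- Riemann-Liouville fractional integral for real valued functions. -/
def RLreal (β : ℝ) (φ : ℝ → ℝ) (t : ℝ) : ℝ :=
  (Real.Gamma β)⁻¹ * ∫ s in Set.Ioc (0 : ℝ) t, ((t - s) ^ (β - 1) : ℝ) * φ s

/-- The Caputo fractional derivative `∂^α_t` of order `α ∈ (0,2)`:
`∂^α_t φ = (d/dt)^n I^{n-α}(φ - ∑_{k<n} t^k/k! φ^{(k)}(0))`, with `n = 1` for `α < 1`
and `n = 2` for `α > 1` (ordinary derivative for `α = 1`). -/
def caputo (α : ℝ) (φ : ℝ → ℂ) : ℝ → ℂ :=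
  if α = 1 then deriv φ
  else
    let n : ℕ := if α < 1 then 1 else 2
    iteratedDeriv n (RL ((n : ℝ) - α) fun s =>
      φ s - ∑ k ∈ Finset.range n, ((s ^ k / (Nat.factorial k) : ℝ) : ℂ) * iteratedDeriv k φ 0)

/-- The Caputo derivative in time of a space-time function. -/
def caputoST {d : ℕ} (α : ℝ) (u : ℝ → Rd d → ℂ) : ℝ → Rd d → ℂ :=
  fun t x => caputo α (fun s => u s x) t

/-- `u ∈ 𝔹H^{α,γ+2}_{q,p,0}(w₂,w₁,T)` with Caputo derivative `∂^α_t u = f`: there is a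
sequence of smooth functions vanishing (together with `∂_t` if `α > 1`) at `t = 0`,
converging to `u` in `𝔹H^{γ+2}_{q,p}` whose Caputo derivatives converge to `f` in
`𝔹H^{γ}_{q,p}`. -/
def InSolSpace0 {d : ℕ} (α γ q p : ℝ) (w2 : ℝ → ℝ) (w1 : Rd d → ℝ) (T : ℝ)
    (u f : ℝ → Rd d → ℂ) : Prop :=
  mixNorm (γ + 2) q p w2 w1 T u < ⊤ ∧ mixNorm γ q p w2 w1 T f < ⊤ ∧
  ∃ un : ℕ → ℝ → Rd d → ℂ,
    (∀ n, ContDiff ℝ (⊤ : ℕ∞) fun pa : ℝ × Rd d => un n pa.1 pa.2) ∧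
    (∀ n x, un n 0 x = 0) ∧
    (1 < α → ∀ n x, deriv (fun t => un n t x) 0 = 0) ∧
    Tendsto (fun n => mixNorm (γ + 2) q p w2 w1 T fun t x => un n t x - u t x) atTop (𝓝 0) ∧
    Tendsto (fun n => mixNorm γ q p w2 w1 T fun t x => caputoST α (un n) t x - f t x)
      atTop (𝓝 0)

/-- First order spatial derivative `u_{x^i}`. -/
def dx {d : ℕ} (v : Rd d → ℂ) (i : Fin d) (x : Rd d) : ℂ :=
  fderiv ℝ v x (EuclideanSpace.single i 1)

/-- Second order spatial derivative `u_{x^i x^j}`. -/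
def dxx {d : ℕ} (v : Rd d → ℂ) (i j : Fin d) (x : Rd d) : ℂ :=
  fderiv ℝ (fun y => dx v j y) x (EuclideanSpace.single i 1)

/-- Supremum of the `k`-th derivative. -/
def supIFD {d : ℕ} (k : ℕ) (g : Rd d → ℝ) : ℝ≥0∞ :=
  ⨆ x : Rd d, (‖iteratedFDeriv ℝ k g x‖₊ : ℝ≥0∞)

/-- Hölder seminorm of exponent `σ` of the `k`-th derivative. -/
def holderSemi {d : ℕ} (σ : ℝ) (k : ℕ) (g : Rd d → ℝ) : ℝ≥0∞ :=
  ⨆ pq : {pq : Rd d × Rd d // pq.1 ≠ pq.2},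
    (‖iteratedFDeriv ℝ k g pq.1.1 - iteratedFDeriv ℝ k g pq.1.2‖₊ : ℝ≥0∞) /
      ENNReal.ofReal (‖pq.1.1 - pq.1.2‖ ^ σ)

/-- The smoothness order required for membership in `B^r` (with auxiliary `κ'`). -/
def Bsmooth (r κ' : ℝ) : ℕ :=
  if r = 0 then 0 else if ∃ m : ℕ, r = (m : ℝ) then ⌈r⌉₊ - 1 else ⌊r + κ'⌋₊

/-- The norm of the space `B^r`: `L_∞` for `r = 0`, `C^{r-1,1}` for `r` a positive
integer, and the Hölder space `C^{r+κ'}` otherwise. -/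
def Bnorm {d : ℕ} (r κ' : ℝ) (g : Rd d → ℝ) : ℝ≥0∞ :=
  if r = 0 then supIFD 0 g
  else if ∃ m : ℕ, r = (m : ℝ) then
    (∑ k ∈ Finset.range ⌈r⌉₊, supIFD k g) + holderSemi 1 (⌈r⌉₊ - 1) g
  else
    (∑ k ∈ Finset.range (⌊r + κ'⌋₊ + 1), supIFD k g) +
      holderSemi (r + κ' - (⌊r + κ'⌋₊ : ℝ)) ⌊r + κ'⌋₊ g

/-- Admissibility of the auxiliary Hölder parameter `κ'` for the space `B^r`:
`κ' = 0` if `r` is an integer, and otherwise `κ' ∈ (0,1)` with `r + κ'` not an integer. -/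
def ValidKappa (r κ' : ℝ) : Prop :=
  ((∃ m : ℕ, r = (m : ℝ)) → κ' = 0) ∧
  (¬(∃ m : ℕ, r = (m : ℝ)) → 0 < κ' ∧ κ' < 1 ∧ ¬∃ m : ℕ, r + κ' = (m : ℝ))

/-- Membership `g ∈ B^r` with norm at most `C`. -/
def MemB {d : ℕ} (r κ' : ℝ) (g : Rd d → ℝ) (C : ℝ) : Prop :=
  ContDiff ℝ (Bsmooth r κ') g ∧ Bnorm r κ' g ≤ ENNReal.ofReal C

/-- Convolution of complex valued functions on `ℝ^d`. -/
def conv {d : ℕ} (f g : Rd d → ℂ) : Rd d → ℂ :=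
  MeasureTheory.convolution f g (ContinuousLinearMap.mul ℂ ℂ) volume

/-- Dyadic dilate `Φ_j(x) = 2^{jd} Φ(2^j x)`. -/
def dyad {d : ℕ} (Φ : Rd d → ℂ) (j : ℤ) : Rd d → ℂ :=
  fun x => (((2 : ℝ) ^ (j * (d : ℤ)) : ℝ) : ℂ) * Φ (((2 : ℝ) ^ j) • x)

/-- A function bounded by `C` on an interval has mean at most `C` there. -/
lemma setAverage_ball_le_of_norm_le {f : ℝ → ℝ} {c r C : ℝ} (hr : 0 < r)
    (h : ∀ x ∈ ball c r, ‖f x‖ ≤ C) : ⨍ x in ball c r, f x ≤ C := by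
  have hvol : volume.real (ball c r) = 2 * r := Real.volume_real_ball hr.le
  have hint : ‖∫ x in ball c r, f x‖ ≤ C * volume.real (ball c r) :=
    norm_setIntegral_le_of_norm_le_const measure_ball_lt_top h
  rw [setAverage_eq, smul_eq_mul, hvol, inv_mul_le_iff₀ (by positivity)]
  rw [hvol] at hint
  linarith [le_abs_self (∫ x in ball c r, f x), Real.norm_eq_abs (∫ x in ball c r, f x)]

lemma intervalIntegrable_abs_rpow {s : ℝ} (hs : -1 < s) (R : ℝ) :
    IntervalIntegrable (fun x : ℝ => |x| ^ s) volume (-R) R := by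
  have key : ∀ c : ℝ, 0 ≤ c → IntervalIntegrable (fun x : ℝ => |x| ^ s) volume 0 c := by
    intro c hc
    refine (intervalIntegral.intervalIntegrable_rpow' (a := 0) (b := c) hs).congr ?_
    intro x hx
    rw [uIoc_of_le hc] at hx
    simp only [abs_of_pos hx.1]
  have key' : ∀ c : ℝ, IntervalIntegrable (fun x : ℝ => |x| ^ s) volume 0 c := by
    intro c
    rcases le_total 0 c with hc | hc
    · exact key c hc
    · rw [IntervalIntegrable.iff_comp_neg]
      simpa using key (-c) (by linarith)
  exact (key' (-R)).symm.trans (key' R)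

lemma integral_abs_rpow_symm {s R : ℝ} (hs : -1 < s) (hR : 0 ≤ R) :
    ∫ x in (-R)..R, |x| ^ s = 2 * (R ^ (s + 1) / (s + 1)) := by
  have hpos : ∫ x in (0 : ℝ)..R, |x| ^ s = R ^ (s + 1) / (s + 1) := by
    rw [intervalIntegral.integral_congr (g := fun x : ℝ => x ^ s), integral_rpow (Or.inl hs),
      Real.zero_rpow (by linarith), sub_zero]
    intro x hx
    rw [uIcc_of_le hR] at hx
    simp only [abs_of_nonneg hx.1]
  have hneg : ∫ x in (-R)..0, |x| ^ s = ∫ x in (0 : ℝ)..R, |x| ^ s := by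
    simpa using intervalIntegral.integral_comp_neg (a := -R) (b := 0) fun x : ℝ => |x| ^ s
  have hi := intervalIntegrable_abs_rpow hs R
  have hsub : ∀ a b : ℝ, a ∈ Icc (-R) R → b ∈ Icc (-R) R →
      IntervalIntegrable (fun x : ℝ => |x| ^ s) volume a b := fun a b ha hb =>
    hi.mono_set (by
      rw [uIcc_of_le (by linarith : -R ≤ R)]
      exact uIcc_subset_Icc ha hb)
  have h0 : (0 : ℝ) ∈ Icc (-R) R := ⟨by linarith, hR⟩
  rw [← intervalIntegral.integral_add_adjacent_intervals
    (hsub (-R) 0 ⟨le_rfl, by linarith⟩ h0) (hsub 0 R h0 ⟨by linarith, le_rfl⟩), hneg, hpos]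
  ring

/-- The mean of `|x|^{-1/2}` over an interval of radius `r` lying in `(-3r, 3r)`. -/
lemma setAverage_inv_sqrt_le_of_near {c r : ℝ} (hr : 0 < r) (hc : |c| ≤ 2 * r) :
    ⨍ x in ball c r, |x| ^ (-(1 : ℝ) / 2) ≤ 2 * √(3 * r) / r := by
  have hi := intervalIntegrable_abs_rpow (s := -(1 : ℝ) / 2) (by norm_num) (3 * r)
  rw [intervalIntegrable_iff_integrableOn_Ioc_of_le (by linarith)] at hi
  have hsub : ball c r ⊆ Ioc (-(3 * r)) (3 * r) := by
    rw [Real.ball_eq_Ioo]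
    intro x hx
    have := abs_le.mp hc
    exact ⟨by linarith [hx.1], by linarith [hx.2]⟩
  have hle : ∫ x in ball c r, |x| ^ (-(1 : ℝ) / 2) ≤
      ∫ x in Ioc (-(3 * r)) (3 * r), |x| ^ (-(1 : ℝ) / 2) :=
    setIntegral_mono_set hi (Eventually.of_forall fun x => by positivity) hsub.eventuallyLE
  rw [← intervalIntegral.integral_of_le (by linarith),
    integral_abs_rpow_symm (by norm_num) (by linarith),
    show -(1 : ℝ) / 2 + 1 = 1 / 2 by norm_num, ← Real.sqrt_eq_rpow] at hle
  rw [setAverage_eq, smul_eq_mul, Real.volume_real_ball hr.le, inv_mul_le_iff₀ (by positivity)]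
  refine hle.trans (le_of_eq ?_)
  field_simp

lemma apRatio_sqrt_abs_le {c r : ℝ} (hr : 0 < r) :
    apRatio 2 (fun x : ℝ => |x| ^ ((1 : ℝ) / 2)) c r ≤ 6 := by
  have hw : ∀ x : ℝ, (|x| ^ ((1 : ℝ) / 2)) ^ (-(1 : ℝ) / (2 - 1)) = |x| ^ (-(1 : ℝ) / 2) := by
    intro x
    rw [← Real.rpow_mul (abs_nonneg x)]
    norm_num
  have hexp : (2 : ℝ) - 1 = 1 := by norm_num
  have hnonneg : 0 ≤ ⨍ x in ball c r, |x| ^ (-(1 : ℝ) / 2) := by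
    rw [setAverage_eq]
    exact smul_nonneg (by positivity) (integral_nonneg fun x => by positivity)
  have hmem : ∀ x ∈ ball c r, |x| ≤ |c| + r ∧ |c| - r ≤ |x| := by
    intro x hx
    rw [mem_ball, Real.dist_eq] at hx
    have h1 := abs_sub_abs_le_abs_sub x c
    have h2 := abs_sub_abs_le_abs_sub c x
    rw [abs_sub_comm] at h2
    exact ⟨by linarith, by linarith⟩
  have hup : ⨍ x in ball c r, |x| ^ ((1 : ℝ) / 2) ≤ √(|c| + r) := by
    refine setAverage_ball_le_of_norm_le hr fun x hx => ?_
    rw [← Real.sqrt_eq_rpow, Real.norm_of_nonneg (Real.sqrt_nonneg _)]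
    exact Real.sqrt_le_sqrt (hmem x hx).1
  unfold apRatio
  simp only [hw]
  rw [hexp, Real.rpow_one]
  refine (mul_le_mul_of_nonneg_right hup hnonneg).trans ?_
  rcases le_total |c| (2 * r) with hc | hc
  · calc √(|c| + r) * ⨍ x in ball c r, |x| ^ (-(1 : ℝ) / 2)
        ≤ √(3 * r) * (2 * √(3 * r) / r) := by
          gcongr
          · linarith
          · exact setAverage_inv_sqrt_le_of_near hr hc
      _ = 2 * (√(3 * r) * √(3 * r)) / r := by ring
      _ = 6 := by
          rw [Real.mul_self_sqrt (by positivity)]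
          field_simp
          norm_num
  · have hpos : 0 < |c| - r := by linarith
    have hdown : ⨍ x in ball c r, |x| ^ (-(1 : ℝ) / 2) ≤ (√(|c| - r))⁻¹ := by
      refine setAverage_ball_le_of_norm_le hr fun x hx => ?_
      rw [Real.norm_of_nonneg (by positivity), neg_div, Real.rpow_neg (abs_nonneg x),
        ← Real.sqrt_eq_rpow]
      exact inv_anti₀ (Real.sqrt_pos.mpr hpos) (Real.sqrt_le_sqrt (hmem x hx).2)
    have hsqrt : √(|c| + r) ≤ 6 * √(|c| - r) := by
      rw [Real.sqrt_le_left (by positivity), mul_pow, Real.sq_sqrt hpos.le]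
      linarith
    calc √(|c| + r) * ⨍ x in ball c r, |x| ^ (-(1 : ℝ) / 2)
        ≤ √(|c| + r) * (√(|c| - r))⁻¹ := by gcongr
      _ ≤ 6 := by
          rwa [← div_eq_mul_inv, div_le_iff₀ (Real.sqrt_pos.mpr hpos)]

lemma isAp_two_sqrt_abs : IsAp (E := ℝ) 2 (fun x => |x| ^ ((1 : ℝ) / 2)) where
  nonneg x := by positivity
  locInt := (continuous_abs.rpow_const fun _ => Or.inr (by norm_num)).locallyIntegrable
  bdd := ⟨6, by
    rintro _ ⟨⟨c, r, hr⟩, rfl⟩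
    exact apRatio_sqrt_abs_le hr⟩

/-- Near the origin, `|ξ|^{-1/2}` dominates any prescribed multiple of `|ξ|^{1/2}`. -/
lemma mul_abs_rpow_half_le {ξ M : ℝ} (h : |ξ| * M ≤ 1) :
    M * |ξ| ^ ((1 : ℝ) / 2) ≤ |ξ| ^ (-(1 : ℝ) / 2) := by
  rcases eq_or_ne ξ 0 with rfl | hξ
  · simp
  · have hpos : 0 < |ξ| := abs_pos.mpr hξ
    have hsplit : |ξ| ^ ((1 : ℝ) / 2) = |ξ| * |ξ| ^ (-(1 : ℝ) / 2) := by
      rw [← Real.rpow_one_add' hpos.le (by norm_num)]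
      norm_num
    rw [hsplit]
    calc M * (|ξ| * |ξ| ^ (-(1 : ℝ) / 2)) = (|ξ| * M) * |ξ| ^ (-(1 : ℝ) / 2) := by ring
      _ ≤ 1 * |ξ| ^ (-(1 : ℝ) / 2) := by gcongr
      _ = _ := one_mul _

/-- There are nonzero Schwartz functions supported arbitrarily close to the origin. -/
lemma exists_schwartzMap_supported_near_zero {ε : ℝ} (hε : 0 < ε) :
    ∃ g : SchwartzMap ℝ ℂ, HasCompactSupport g ∧ Function.support g = ball 0 ε := by
  let φ : ContDiffBump (0 : ℝ) := ⟨ε / 2, ε, by linarith, by linarith⟩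
  have hsupp : Function.support (fun x => (φ x : ℂ)) = ball 0 ε := by
    rw [← φ.support_eq]
    ext x
    simp
  have hcomp : HasCompactSupport fun x => (φ x : ℂ) :=
    φ.hasCompactSupport.comp_left (g := ((↑) : ℝ → ℂ)) Complex.ofReal_zero
  exact ⟨hcomp.toSchwartzMap (Complex.ofRealCLM.contDiff.comp φ.contDiff), hcomp, hsupp⟩

lemma lintegral_sq_mul_sqrt_abs_ne_top {g : ℝ → ℂ} (hg : Continuous g)
    (hc : HasCompactSupport g) :
    ∫⁻ ξ : ℝ, (‖g ξ‖₊ : ℝ≥0∞) ^ (2 : ℕ) * ENNReal.ofReal (|ξ| ^ ((1 : ℝ) / 2)) ≠ ∞ := by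
  have hcont : Continuous fun ξ : ℝ => ‖g ξ‖ ^ 2 * |ξ| ^ ((1 : ℝ) / 2) :=
    (hg.norm.pow 2).mul (continuous_abs.rpow_const fun _ => Or.inr (by norm_num))
  have hsupp : HasCompactSupport fun ξ : ℝ => ‖g ξ‖ ^ 2 * |ξ| ^ ((1 : ℝ) / 2) :=
    (hc.comp_left (g := fun z : ℂ => ‖z‖ ^ 2) (by simp)).mul_right
  convert (hcont.integrable_of_hasCompactSupport (μ := volume) hsupp).lintegral_lt_top.ne using 3
    with ξ
  rw [ENNReal.ofReal_mul (by positivity), ENNReal.ofReal_pow (norm_nonneg _), ofReal_norm]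
  rfl

lemma lintegral_sq_mul_sqrt_abs_ne_zero {g : ℝ → ℂ} {ε : ℝ} (hε : 0 < ε) (hg : Continuous g)
    (hs : Function.support g = ball 0 ε) :
    ∫⁻ ξ : ℝ, (‖g ξ‖₊ : ℝ≥0∞) ^ (2 : ℕ) * ENNReal.ofReal (|ξ| ^ ((1 : ℝ) / 2)) ≠ 0 := by
  have hw : Continuous fun ξ : ℝ => |ξ| ^ ((1 : ℝ) / 2) :=
    continuous_abs.rpow_const fun _ => Or.inr (by norm_num)
  have hmeas : Measurable fun ξ : ℝ =>
      (‖g ξ‖₊ : ℝ≥0∞) ^ (2 : ℕ) * ENNReal.ofReal (|ξ| ^ ((1 : ℝ) / 2)) :=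
    (hg.measurable.nnnorm.coe_nnreal_ennreal.pow_const 2).mul hw.measurable.ennreal_ofReal
  rw [← pos_iff_ne_zero, lintegral_pos_iff_support hmeas]
  have hsub : Ioo 0 ε ⊆ Function.support fun ξ : ℝ =>
      (‖g ξ‖₊ : ℝ≥0∞) ^ (2 : ℕ) * ENNReal.ofReal (|ξ| ^ ((1 : ℝ) / 2)) := by
    intro ξ hξ
    have hgξ : g ξ ≠ 0 := by
      rw [← Function.mem_support, hs, mem_ball_zero_iff, Real.norm_of_nonneg hξ.1.le]
      exact hξ.2
    have hpos : 0 < |ξ| ^ ((1 : ℝ) / 2) := Real.rpow_pos_of_pos (abs_pos.mpr hξ.1.ne') _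
    exact mul_ne_zero (pow_ne_zero _ (by simpa using hgξ)) (by simpa using hpos)
  refine lt_of_lt_of_le ?_ (measure_mono hsub)
  simpa using hε

/-- `w(x) = |x|^{1/2}` is an `A₂(ℝ)` weight, yet the Parseval-type
inequality `∫ |g(ξ)|²|ξ|^{-1/2} dξ ≤ N ∫ |g(ξ)|²|ξ|^{1/2} dξ` fails for Schwartz `g`. -/
theorem weighted_parseval_fails :
    IsAp (E := ℝ) 2 (fun x => |x| ^ ((1 : ℝ) / 2)) ∧
    ¬∃ N : ℝ≥0, ∀ g : SchwartzMap ℝ ℂ,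
      (∫⁻ ξ : ℝ, (‖g ξ‖₊ : ℝ≥0∞) ^ (2 : ℕ) * ENNReal.ofReal (|ξ| ^ (-(1 : ℝ) / 2))) ≤
        N * ∫⁻ ξ : ℝ, (‖g ξ‖₊ : ℝ≥0∞) ^ (2 : ℕ) * ENNReal.ofReal (|ξ| ^ ((1 : ℝ) / 2)) := by
  refine ⟨isAp_two_sqrt_abs, ?_⟩
  rintro ⟨N, hN⟩
  have hε : (0 : ℝ) < ((N : ℝ) + 1)⁻¹ := by positivity
  obtain ⟨g, hc, hs⟩ := exists_schwartzMap_supported_near_zero hε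
  have hfin := lintegral_sq_mul_sqrt_abs_ne_top g.continuous hc
  have hpos := lintegral_sq_mul_sqrt_abs_ne_zero hε g.continuous hs
  have hle : ((N + 1 : ℝ≥0) : ℝ≥0∞) *
      ∫⁻ ξ : ℝ, (‖g ξ‖₊ : ℝ≥0∞) ^ (2 : ℕ) * ENNReal.ofReal (|ξ| ^ ((1 : ℝ) / 2)) ≤
      ∫⁻ ξ : ℝ, (‖g ξ‖₊ : ℝ≥0∞) ^ (2 : ℕ) * ENNReal.ofReal (|ξ| ^ (-(1 : ℝ) / 2)) := by
    rw [← lintegral_const_mul' _ _ ENNReal.coe_ne_top]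
    refine lintegral_mono fun ξ => ?_
    rw [mul_left_comm]
    by_cases hξ : g ξ = 0
    · simp [hξ]
    · have hball : |ξ| < ((N : ℝ) + 1)⁻¹ := by
        rwa [← ne_eq, ← Function.mem_support, hs, mem_ball_zero_iff, Real.norm_eq_abs] at hξ
      have hM : |ξ| * ((N : ℝ) + 1) ≤ 1 :=
        (le_div_iff₀ (by positivity)).mp (by simpa using hball.le)
      gcongr
      rw [← ENNReal.ofReal_coe_nnreal, ← ENNReal.ofReal_mul (by positivity)]
      exact ENNReal.ofReal_le_ofReal (mul_abs_rpow_half_le (by simpa using hM))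
  have hcancel := (ENNReal.mul_le_mul_iff_left hpos hfin).mp (hle.trans (hN g))
  rw [ENNReal.coe_le_coe] at hcancel
  exact absurd hcancel (not_le.mpr (lt_add_one N))
end
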